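/- Let β ∈ (0, 2) with β ≠ 1, and let f : ℝ → ℝ be a bounded measurable 1-periodic function which is either everywhere nonnegative or everywhere nonpositive and which is nonzero off a Lebesgue null set. For θ = (θ₁, θ₂) ∈ (0, ∞)² set N_θ(u₁, u₂) = u₂^β ∫_0^1 exp(−β(θ₁x + θ₂f(x))) dx + (u₁ + u₂ e^{−θ₁})^β ∫_0^∞ exp(−β(θ₁x + θ₂f(x))) dx. If θ, θ̃ ∈ (0, ∞)² satisfy N_θ(u₁, u₂) = N_{θ̃}(u₁, u₂) for all u₁ > u₂ ≥ 0, then θ = θ̃. -/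

import Mathlib

open MeasureTheory in
/-- An exponential of minus a linear function with positive slope, perturbed by a bounded
measurable function, is integrable on the positive half-line. -/
lemma integrableOn_exp_neg_mul_add_bounded {β a b : ℝ} (hβ : 0 < β) (ha : 0 < a)
    {f : ℝ → ℝ} (hf : Measurable f) (hbdd : ∃ M, ∀ x, |f x| ≤ M) :
    IntegrableOn (fun x => Real.exp (-(β * (a * x + b * f x)))) (Set.Ioi 0) := by
  obtain ⟨M, hM⟩ := hbdd
  have hexp : IntegrableOn (fun x => Real.exp (β * (|b| * M)) * Real.exp (-(β * a) * x))
      (Set.Ioi 0) :=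
    (exp_neg_integrableOn_Ioi 0 (mul_pos hβ ha)).const_mul _
  refine Integrable.mono' hexp (by fun_prop) (Filter.Eventually.of_forall fun x => ?_)
  rw [Real.norm_eq_abs, Real.abs_exp, ← Real.exp_add, Real.exp_le_exp]
  have hbf : -(b * f x) ≤ |b| * M :=
    (neg_le_abs _).trans (abs_mul b (f x) ▸ mul_le_mul_of_nonneg_left (hM x) (abs_nonneg b))
  linarith [mul_le_mul_of_nonneg_left hbf hβ.le]

/-- If the difference of two shifted powers with exponent `β ∉ {0, 1}` is constant,
then the shifts agree. -/
lemma eq_of_rpow_add_sub_rpow_add_const {β a b c : ℝ} (hβ0 : β ≠ 0) (hβ1 : β ≠ 1)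
    (ha : 0 ≤ a) (hb : 0 ≤ b)
    (h : ∀ u : ℝ, 1 < u → (u + a) ^ β - (u + b) ^ β = c) : a = b := by
  have hpow : ∀ d : ℝ, 0 ≤ d →
      HasDerivAt (fun u : ℝ => (u + d) ^ β) (1 * β * (2 + d) ^ (β - 1)) 2 := fun d hd =>
    ((hasDerivAt_id (2 : ℝ)).add_const d).rpow_const (Or.inl (by simp; positivity))
  have hconst : HasDerivAt (fun u : ℝ => (u + a) ^ β - (u + b) ^ β) 0 2 :=
    (hasDerivAt_const (2 : ℝ) c).congr_of_eventuallyEq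
      (Filter.eventually_of_mem (Ioi_mem_nhds one_lt_two) h)
  have hderiv := ((hpow a ha).sub (hpow b hb)).unique hconst
  have hrpow : (2 + a) ^ (β - 1) = (2 + b) ^ (β - 1) :=
    mul_left_cancel₀ (mul_ne_zero one_ne_zero hβ0) (sub_eq_zero.mp hderiv)
  exact add_left_cancel
    ((Real.rpow_left_inj (by positivity) (by positivity) (sub_ne_zero.mpr hβ1)).mp hrpow)

open MeasureTheory in
/-- For `f` bounded, of constant sign and almost everywhere nonzero, the integral of
`exp (-β (a x + b f x))` over the positive half-line determines `b`. -/
lemma eq_of_integral_exp_neg_mul_add_eq {β a b b' : ℝ} (hβ : 0 < β) (ha : 0 < a)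
    {f : ℝ → ℝ} (hf : Measurable f) (hbdd : ∃ M, ∀ x, |f x| ≤ M)
    (hsign : (∀ x, 0 ≤ f x) ∨ (∀ x, f x ≤ 0)) (hne : volume {x : ℝ | f x = 0} = 0)
    (h : ∫ x in Set.Ioi (0 : ℝ), Real.exp (-(β * (a * x + b * f x)))
      = ∫ x in Set.Ioi (0 : ℝ), Real.exp (-(β * (a * x + b' * f x)))) : b = b' := by
  have hint := fun d : ℝ => integrableOn_exp_neg_mul_add_bounded (b := d) hβ ha hf hbdd
  have hmono : ∀ {d e : ℝ}, (∀ x, d * f x ≤ e * f x) → ∀ x,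
      Real.exp (-(β * (a * x + e * f x))) ≤ Real.exp (-(β * (a * x + d * f x))) := by
    intro d e hde x
    have := hde x
    gcongr
  have hae : (fun x => Real.exp (-(β * (a * x + b * f x))))
      =ᵐ[volume.restrict (Set.Ioi 0)] fun x => Real.exp (-(β * (a * x + b' * f x))) := by
    have hcmp : (∀ x, b * f x ≤ b' * f x) ∨ (∀ x, b' * f x ≤ b * f x) := by
      rcases hsign with hs | hs <;> rcases le_total b b' with hb | hb
      · exact Or.inl fun x => mul_le_mul_of_nonneg_right hb (hs x)
      · exact Or.inr fun x => mul_le_mul_of_nonneg_right hb (hs x)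
      · exact Or.inr fun x => mul_le_mul_of_nonpos_right hb (hs x)
      · exact Or.inl fun x => mul_le_mul_of_nonpos_right hb (hs x)
    rcases hcmp with hc | hc
    · exact ((integral_eq_iff_of_ae_le (hint b') (hint b)
        (Filter.Eventually.of_forall (hmono hc))).mp h.symm).symm
    · exact (integral_eq_iff_of_ae_le (hint b) (hint b')
        (Filter.Eventually.of_forall (hmono hc))).mp h
  have hfne : ∀ᵐ x ∂volume.restrict (Set.Ioi (0 : ℝ)), f x ≠ 0 :=
    ae_restrict_of_ae (ae_iff.mpr (by simpa using hne))
  have : (ae (volume.restrict (Set.Ioi (0 : ℝ)))).NeBot := by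
    rw [ae_neBot, Ne, Measure.restrict_eq_zero]
    simp
  obtain ⟨x, hx, hfx⟩ := (hae.and hfne).exists
  have hlin : β * (a * x + b * f x) = β * (a * x + b' * f x) :=
    neg_injective (Real.exp_injective hx)
  exact mul_right_cancel₀ hfx (add_left_cancel (mul_left_cancel₀ hβ.ne' hlin))

/-- Identifiability claim of Example 2.4 (Appendix A.3) of the paper: for `β ∈ (0,2)`,
`β ≠ 1`, and `f` bounded, measurable, 1-periodic, of constant sign and nonzero off a
Lebesgue null set, the family of values
`N_θ(u₁,u₂) = u₂^β ∫_0^1 e^{−β(θ₁x+θ₂f(x))} dx + (u₁+u₂e^{−θ₁})^β ∫_0^∞ e^{−β(θ₁x+θ₂f(x))} dx`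
over `u₁ > u₂ ≥ 0` determines `θ = (θ₁,θ₂) ∈ (0,∞)²` uniquely. -/
theorem stmt7 (β : ℝ) (hβ0 : 0 < β) (hβ2 : β < 2) (hβ1 : β ≠ 1)
    (f : ℝ → ℝ) (hf_meas : Measurable f) (hf_bdd : ∃ M, ∀ x, |f x| ≤ M)
    (hf_per : ∀ x, f (x + 1) = f x)
    (hf_sign : (∀ x, 0 ≤ f x) ∨ (∀ x, f x ≤ 0))
    (hf_ne : MeasureTheory.volume {x : ℝ | f x = 0} = 0)
    (θ₁ θ₂ θ₁' θ₂' : ℝ) (hθ₁ : 0 < θ₁) (hθ₂ : 0 < θ₂) (hθ₁' : 0 < θ₁') (hθ₂' : 0 < θ₂')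
    (heq : ∀ u₁ u₂ : ℝ, 0 ≤ u₂ → u₂ < u₁ →
      u₂ ^ β * (∫ x in (0:ℝ)..1, Real.exp (-(β * (θ₁ * x + θ₂ * f x))))
        + (u₁ + u₂ * Real.exp (-θ₁)) ^ β *
            (∫ x in Set.Ioi (0:ℝ), Real.exp (-(β * (θ₁ * x + θ₂ * f x))))
      = u₂ ^ β * (∫ x in (0:ℝ)..1, Real.exp (-(β * (θ₁' * x + θ₂' * f x))))
        + (u₁ + u₂ * Real.exp (-θ₁')) ^ β *
            (∫ x in Set.Ioi (0:ℝ), Real.exp (-(β * (θ₁' * x + θ₂' * f x))))) :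
    θ₁ = θ₁' ∧ θ₂ = θ₂' := by
  have hC : ∫ x in Set.Ioi (0 : ℝ), Real.exp (-(β * (θ₁ * x + θ₂ * f x)))
      = ∫ x in Set.Ioi (0 : ℝ), Real.exp (-(β * (θ₁' * x + θ₂' * f x))) := by
    simpa [Real.zero_rpow hβ0.ne'] using heq 1 0 le_rfl one_pos
  have hpos : 0 < ∫ x in Set.Ioi (0 : ℝ), Real.exp (-(β * (θ₁ * x + θ₂ * f x))) := by
    have : NeZero (MeasureTheory.volume.restrict (Set.Ioi (0 : ℝ))) :=
      ⟨by rw [Ne, MeasureTheory.Measure.restrict_eq_zero]; simp⟩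
    exact MeasureTheory.integral_exp_pos
      (integrableOn_exp_neg_mul_add_bounded hβ0 hθ₁ hf_meas hf_bdd)
  have hexp : Real.exp (-θ₁) = Real.exp (-θ₁') := by
    refine eq_of_rpow_add_sub_rpow_add_const hβ0.ne' hβ1 (Real.exp_pos _).le
      (Real.exp_pos _).le fun u hu => eq_div_of_mul_eq hpos.ne' (b :=
        (∫ x in (0 : ℝ)..1, Real.exp (-(β * (θ₁' * x + θ₂' * f x))))
          - ∫ x in (0 : ℝ)..1, Real.exp (-(β * (θ₁ * x + θ₂ * f x)))) ?_
    have h := heq u 1 zero_le_one hu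
    simp only [Real.one_rpow, one_mul, ← hC] at h
    rw [sub_mul]
    exact sub_eq_sub_iff_add_eq_add.mpr ((add_comm _ _).trans h)
  have hθ : θ₁ = θ₁' := neg_injective (Real.exp_injective hexp)
  subst hθ
  exact ⟨rfl, eq_of_integral_exp_neg_mul_add_eq hβ0 hθ₁ hf_meas hf_bdd hf_sign hf_ne hC⟩
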